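/- arXiv:2006.11226 — 3 statements merged into one kernel-verified Lean document; each statement's English description precedes it below -/
import Mathlib

section
/- Let f : ℝ^d → ℝ be convex, differentiable, bounded below by 0, with unattained infimum, and let the step size η > 0 satisfy the descent condition f(w_{t+1}) − f(w_t) ≤ −(η/2)‖∇f(w_t)‖² for all t ≥ 0 together with η ≤ 1/(2 f(w_0)). If the gradient descent iterates satisfy lim_{t→∞} w_t/‖w_t‖ = ū for some unit vector ū, then also lim_{B→∞} w̄(B)/B = ū, where w̄(B) := argmin_{‖w‖≤B} f(w). -/
open Filter

lemma aux_bound (g : ℕ → ℝ) (T : ℕ) : ∃ M : ℝ, 0 ≤ M ∧ ∀ t, t ≤ T → g t < M := by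
  induction T with
  | zero =>
    refine ⟨max 0 (g 0 + 1), le_max_left _ _, fun t ht => ?_⟩
    obtain rfl : t = 0 := by omega
    exact lt_of_lt_of_le (lt_add_one _) (le_max_right _ _)
  | succ k ih =>
    obtain ⟨M, hM, h⟩ := ih
    refine ⟨max M (g (k + 1) + 1), le_max_of_le_left hM, fun t ht => ?_⟩
    rcases Nat.lt_or_ge k t with h1 | h1
    · obtain rfl : t = k + 1 := by omega
      exact lt_of_lt_of_le (lt_add_one _) (le_max_right _ _)
    · exact lt_of_lt_of_le (h t h1) (le_max_left _ _)

set_option maxHeartbeats 800000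

lemma aux_grad_ineq {d : ℕ} (f : EuclideanSpace ℝ (Fin d) → ℝ)
    (hconv : ConvexOn ℝ Set.univ f) (hdiff : Differentiable ℝ f)
    (x z : EuclideanSpace ℝ (Fin d)) :
    f x + inner ℝ (gradient f x) (z - x) ≤ f z := by
  have h1 : ConvexOn ℝ Set.univ (f ∘ (AffineMap.lineMap x z : ℝ →ᵃ[ℝ] _)) := by
    simpa using hconv.comp_affineMap (AffineMap.lineMap x z : ℝ →ᵃ[ℝ] _)
  have h2 : HasDerivAt (f ∘ (AffineMap.lineMap x z : ℝ →ᵃ[ℝ] _))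
      (fderiv ℝ f x (z - x)) 0 := by
    have hl : HasDerivAt (AffineMap.lineMap x z : ℝ →ᵃ[ℝ] _) (z - x) (0 : ℝ) :=
      AffineMap.hasDerivAt_lineMap
    have hf : HasFDerivAt f (fderiv ℝ f x) ((AffineMap.lineMap x z : ℝ →ᵃ[ℝ] _) 0) := by
      simpa using (hdiff x).hasFDerivAt
    exact hf.comp_hasDerivAt (0 : ℝ) hl
  have h3 := h1.le_slope_of_hasDerivAt (Set.mem_univ 0) (Set.mem_univ 1) one_pos h2
  rw [slope_def_field] at h3
  simp at h3
  rw [inner_gradient_left, map_sub]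
  linarith

lemma aux_geom {E : Type*} [NormedAddCommGroup E] [InnerProductSpace ℝ E]
    (u z a b : E) (hu : ‖u‖ = 1) (B M ρ ε δ : ℝ) (hz : ‖z‖ ≤ B)
    (hb1 : B ≤ ‖b‖) (hb2 : ‖b‖ ≤ 4 * B) (hb3 : ‖b - ‖b‖ • u‖ ≤ ε * ‖b‖)
    (hρ : ρ = max (inner ℝ z u) M) (ha1 : ρ ≤ ‖a‖) (ha2 : ‖a‖ ≤ ρ + 1)
    (ha3 : ‖a - ‖a‖ • u‖ ≤ ε * ‖a‖) (hab : ‖b - z‖ ≤ ‖a - z‖ + 1)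
    (hM : 0 ≤ M) (hMB : 2 * M ≤ B) (hB : 1 ≤ B) (hεB : 2 ≤ ε * B)
    (hε : ε = δ ^ 2 / 400) (hδ : 0 < δ) (hδ1 : δ ≤ 1) :
    (1 - δ) * B ≤ inner ℝ z u := by
  set c := inner ℝ z u with hc
  have hcB : c ≤ B := by
    have := real_inner_le_norm z u
    rw [hu] at this; linarith
  have hε0 : 0 < ε := by rw [hε]; positivity
  have hε1 : ε ≤ 1 / 400 := by rw [hε]; nlinarith
  have hρB : ρ ≤ B := by rw [hρ]; exact max_le hcB (by linarith)
  have hρ0 : 0 ≤ ρ := by rw [hρ]; exact le_max_of_le_right hM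
  have key : ∀ s : ℝ, ‖s • u - z‖ ^ 2 = s ^ 2 - 2 * s * c + ‖z‖ ^ 2 := by
    intro s
    rw [norm_sub_sq_real, norm_smul, hu, inner_smul_left, real_inner_comm]
    simp [hc]; ring
  have e1 : ‖a - z‖ ≤ ‖ρ • u - z‖ + 1 + 2 * ε * B := by
    have : a - z = (a - ‖a‖ • u) + (‖a‖ - ρ) • u + (ρ • u - z) := by
      rw [sub_smul]; abel
    have h := norm_add₃_le (a := a - ‖a‖ • u) (b := (‖a‖ - ρ) • u) (c := ρ • u - z)
    rw [← this, norm_smul, hu, Real.norm_eq_abs, abs_of_nonneg (by linarith)] at h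
    have : ε * ‖a‖ ≤ ε * (2 * B) := by gcongr; linarith
    linarith
  have e2 : ‖‖b‖ • u - z‖ ≤ ‖b - z‖ + 4 * ε * B := by
    have : ‖b‖ • u - z = (b - z) - (b - ‖b‖ • u) := by abel
    have h := norm_sub_le (b - z) (b - ‖b‖ • u)
    rw [← this] at h
    have : ε * ‖b‖ ≤ ε * (4 * B) := by gcongr
    linarith
  have e3 : ‖ρ • u - z‖ ≤ 2 * B := by
    have h := norm_sub_le (ρ • u) z
    rw [norm_smul, hu, Real.norm_eq_abs, abs_of_nonneg hρ0] at h
    linarith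
  have e4 : ‖‖b‖ • u - z‖ ≤ ‖ρ • u - z‖ + 7 * (ε * B) := by linarith
  have e5 : ‖‖b‖ • u - z‖ ^ 2 ≤ ‖ρ • u - z‖ ^ 2 + 77 * ε * B ^ 2 := by
    have h := pow_le_pow_left₀ (norm_nonneg _) e4 2
    have h1 : ‖ρ • u - z‖ * (ε * B) ≤ 2 * B * (ε * B) := by gcongr
    have h2 : (ε * B) * (ε * B) ≤ (1 * B) * (ε * B) := by gcongr; linarith
    nlinarith
  rw [key, key] at e5
  set r := ‖b‖
  have e6 : 77 * ε * B ^ 2 ≤ (δ * B) ^ 2 / 5 := by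
    rw [hε]; nlinarith [sq_nonneg (δ * B)]
  have e7 : (δ * B) ^ 2 ≤ B ^ 2 := by gcongr; nlinarith
  rcases le_total M c with h | h
  · rw [max_eq_left h] at hρ
    subst hρ
    have h0 : (B - c) ^ 2 ≤ (r - c) ^ 2 := by gcongr
    have : (B - c) ^ 2 ≤ (δ * B) ^ 2 := by nlinarith [sq_nonneg (δ * B)]
    have := abs_le_of_sq_le_sq' this (by positivity)
    linarith [this.2]
  · exfalso
    rw [max_eq_right h] at hρ
    subst hρ
    have h1 : (B / 2) * (B / 2) ≤ (r - ρ) * (r + ρ - 2 * c) := by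
      apply mul_le_mul <;> linarith
    nlinarith

/-- If `f` is convex, differentiable, bounded below by `0`,
with unattained infimum, the step size satisfies the descent condition and
`η ≤ 1/(2 f(w₀))`, and the gradient descent iterates converge in direction to a
unit vector `ū`, then the regularization path `w̄(B) = argmin_{‖w‖≤B} f(w)`
also converges in direction to `ū`. -/
theorem regularization_path_follows_gradient_descent_direction
    {d : ℕ} (f : EuclideanSpace ℝ (Fin d) → ℝ)
    (hconv : ConvexOn ℝ Set.univ f)
    (hdiff : Differentiable ℝ f)
    (hbdd : ∀ v, 0 ≤ f v)
    (hunatt : ∀ u, ∃ v, f v < f u)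
    (η : ℝ) (hη : 0 < η)
    (w : ℕ → EuclideanSpace ℝ (Fin d))
    (hgd : ∀ t : ℕ, w (t + 1) = w t - η • gradient f (w t))
    (hdesc : ∀ t : ℕ, f (w (t + 1)) - f (w t) ≤ -(η / 2) * ‖gradient f (w t)‖ ^ 2)
    (hη2 : η ≤ 1 / (2 * f (w 0)))
    (wbar : ℝ → EuclideanSpace ℝ (Fin d))
    (hwbar : ∀ B : ℝ, 0 ≤ B → ‖wbar B‖ ≤ B ∧ ∀ v, ‖v‖ ≤ B → f (wbar B) ≤ f v)
    (u : EuclideanSpace ℝ (Fin d)) (hu : ‖u‖ = 1)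
    (hlim : Tendsto (fun t : ℕ => ‖w t‖⁻¹ • w t) atTop (nhds u)) :
    Tendsto (fun B : ℝ => B⁻¹ • wbar B) atTop (nhds u) := by
  have hdec : ∀ t, f (w (t + 1)) ≤ f (w t) := fun t => by
    have := hdesc t
    have : 0 ≤ (η / 2) * ‖gradient f (w t)‖ ^ 2 := by positivity
    linarith
  have hanti : Antitone (fun t => f (w t)) := antitone_nat_of_succ_le hdec
  have hf0 : 0 < f (w 0) := by
    obtain ⟨v, hv⟩ := hunatt (w 0)
    exact lt_of_le_of_lt (hbdd v) hv
  have hηf : 2 * η * f (w 0) ≤ 1 := by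
    rw [le_div_iff₀ (by positivity)] at hη2
    linarith
  have hstep : ∀ t, ‖w (t + 1) - w t‖ ≤ 1 := fun t => by
    have h1 : w (t + 1) - w t = - (η • gradient f (w t)) := by rw [hgd]; abel
    rw [h1, norm_neg, norm_smul, Real.norm_eq_abs, abs_of_pos hη]
    have h2 := hdesc t
    have h3 := hbdd (w (t + 1))
    have h4 : f (w t) ≤ f (w 0) := hanti (Nat.zero_le t)
    have h5 : η * (η / 2 * ‖gradient f (w t)‖ ^ 2) ≤ η * f (w 0) := by
      gcongr; linarith
    have h6 : (η * ‖gradient f (w t)‖) ^ 2 ≤ 1 ^ 2 := by nlinarith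
    exact (abs_le_of_sq_le_sq' h6 zero_le_one).2
  have hmono : ∀ t z, ‖w (t + 1) - z‖ ^ 2 ≤ ‖w t - z‖ ^ 2 + 2 * η * (f z - f (w (t + 1))) := by
    intro t z
    have h1 : w (t + 1) - z = (w t - z) - η • gradient f (w t) := by rw [hgd]; abel
    have h2 := aux_grad_ineq f hconv hdiff (w t) z
    have h3 : inner ℝ (gradient f (w t)) (z - w t) = - inner ℝ (w t - z) (gradient f (w t)) := by
      rw [real_inner_comm, ← inner_neg_left, neg_sub]
    rw [h1, norm_sub_sq_real, inner_smul_right, norm_smul, Real.norm_eq_abs, abs_of_pos hη]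
    have h4 := mul_le_mul_of_nonneg_left (hdesc t) hη.le
    rw [h3] at h2
    have h5 := mul_le_mul_of_nonneg_left h2 hη.le
    nlinarith
  have hreach : ∀ z, ∃ N, f (w N) ≤ f z := by
    intro z
    by_contra! hcon
    obtain ⟨v, hv⟩ := hunatt z
    have h1 : ∀ t : ℕ, ‖w t - v‖ ^ 2 ≤ ‖w 0 - v‖ ^ 2 - t * (2 * η * (f z - f v)) := by
      intro t
      induction t with
      | zero => simp
      | succ k ih =>
        have := hmono k v
        have h2 := hcon (k + 1)
        have h3 : 2 * η * (f v - f (w (k + 1))) ≤ 2 * η * (f v - f z) := by gcongr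
        push_cast
        linarith
    have hp : 0 < 2 * η * (f z - f v) := by
      have : 0 < f z - f v := by linarith
      positivity
    obtain ⟨n, hn⟩ := exists_nat_gt (‖w 0 - v‖ ^ 2 / (2 * η * (f z - f v)))
    rw [div_lt_iff₀ hp] at hn
    have := h1 n
    have := sq_nonneg ‖w n - v‖
    linarith
  have hball : ∀ B, 0 ≤ B → ∀ x, f x ≤ f (wbar B) → B ≤ ‖x‖ := by
    intro B hB x hx
    by_contra! hlt
    have hloc : IsLocalMin f x := by
      have : Metric.ball (0 : EuclideanSpace ℝ (Fin d)) B ∈ nhds x :=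
        Metric.isOpen_ball.mem_nhds (by simpa using hlt)
      filter_upwards [this] with v hv
      exact hx.trans ((hwbar B hB).2 v (by simpa using (mem_ball_zero_iff.1 hv).le))
    have := IsMinOn.of_isLocalMin_of_convex_univ hloc hconv
    obtain ⟨v, hv⟩ := hunatt x
    exact absurd (this v) (not_le.2 hv)
  rw [Metric.tendsto_atTop]
  intro τ hτ
  obtain ⟨δ, hδ, hδ1, hδτ⟩ : ∃ δ : ℝ, 0 < δ ∧ δ ≤ 1 ∧ 2 * δ < τ ^ 2 := by
    refine ⟨min 1 (τ ^ 2 / 4), by positivity, min_le_left _ _, ?_⟩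
    have := min_le_right 1 (τ ^ 2 / 4)
    have : 0 < τ ^ 2 := by positivity
    linarith
  obtain ⟨ε, hε⟩ : ∃ ε : ℝ, ε = δ ^ 2 / 400 := ⟨_, rfl⟩
  have hε0 : 0 < ε := by rw [hε]; positivity
  obtain ⟨T, hT⟩ := Metric.tendsto_atTop.1 hlim ε hε0
  have hdir : ∀ t, T ≤ t → ‖w t - ‖w t‖ • u‖ ≤ ε * ‖w t‖ := by
    intro t ht
    rcases eq_or_ne (w t) 0 with h0 | h0
    · simp [h0]
    have hpos : 0 < ‖w t‖ := norm_pos_iff.2 h0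
    have h1 := (hT t ht).le
    rw [dist_eq_norm] at h1
    have h2 : w t - ‖w t‖ • u = ‖w t‖ • (‖w t‖⁻¹ • w t - u) := by
      rw [smul_sub, smul_inv_smul₀ hpos.ne']
    rw [h2, norm_smul, norm_norm, mul_comm]
    gcongr
  obtain ⟨M, hM0, hMw⟩ : ∃ M : ℝ, 0 ≤ M ∧ ∀ t, t ≤ T → ‖w t‖ < M := by
    exact aux_bound (fun t => ‖w t‖) T
  refine ⟨max (max 1 (2 * M)) (2 / ε), fun B hBB => ?_⟩
  have hB1 : 1 ≤ B := (le_max_left _ _).trans ((le_max_left _ _).trans hBB)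
  have hBM : 2 * M ≤ B := (le_max_right _ _).trans ((le_max_left _ _).trans hBB)
  have hBε : 2 ≤ ε * B := by
    have : 2 / ε ≤ B := (le_max_right _ _).trans hBB
    rw [div_le_iff₀ hε0] at this
    linarith
  have hB0 : 0 < B := by linarith
  obtain ⟨z, hzdef⟩ : ∃ z, z = wbar B := ⟨_, rfl⟩
  have hzB : ‖z‖ ≤ B := hzdef ▸ (hwbar B hB0.le).1
  have hinner : (1 - δ) * B ≤ inner ℝ z u := by
    classical
    have hex := hreach z
    obtain ⟨N, hN, hNmin⟩ : ∃ N, f (w N) ≤ f z ∧ ∀ s, s < N → f z < f (w s) :=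
      ⟨Nat.find hex, Nat.find_spec hex, fun s hs => not_le.1 (Nat.find_min hex hs)⟩
    have hNB : B ≤ ‖w N‖ := hball B hB0.le _ (hzdef ▸ hN)
    have hNT : T < N := by
      by_contra! h
      have := hMw N h
      linarith
    have hdist : ∀ s, s ≤ N → ‖w N - z‖ ≤ ‖w s - z‖ + 1 := by
      intro s hs
      have hd : ∀ k, s + k < N → ‖w (s + k) - z‖ ≤ ‖w s - z‖ := by
        intro k
        induction k with
        | zero => intro _; simp
        | succ k ih =>
          intro hk
          refine le_trans ?_ (ih (by omega))
          have h1 := hmono (s + k) z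
          have h2 := hNmin (s + k + 1) (by omega)
          have h3 : 2 * η * (f z - f (w (s + k + 1))) ≤ 0 :=
            mul_nonpos_of_nonneg_of_nonpos (by positivity) (by linarith)
          have h4 : ‖w (s + k + 1) - z‖ ^ 2 ≤ ‖w (s + k) - z‖ ^ 2 := by linarith
          exact (abs_le_of_sq_le_sq' h4 (norm_nonneg _)).2
      rcases hs.eq_or_lt with h | h
      · rw [h]; linarith
      · obtain ⟨k, hk⟩ : ∃ k, N = s + k + 1 := ⟨N - s - 1, by omega⟩
        have h1 := hd k (by omega)
        have h2 := hstep (s + k)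
        have h3 := norm_sub_le_norm_sub_add_norm_sub (w N) (w (s + k)) z
        rw [← hk] at h2
        linarith
    obtain ⟨ρ, hρ⟩ : ∃ ρ, ρ = max (inner ℝ z u) M := ⟨_, rfl⟩
    have hρB : ρ ≤ B := by
      rw [hρ]
      refine max_le ?_ (by linarith)
      have := real_inner_le_norm z u
      rw [hu] at this; linarith
    have hex2 : ∃ s, ρ ≤ ‖w s‖ := ⟨N, hρB.trans hNB⟩
    obtain ⟨s, hs, hsN, hsmin⟩ : ∃ s, ρ ≤ ‖w s‖ ∧ s ≤ N ∧ ∀ i, i < s → ‖w i‖ < ρ :=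
      ⟨Nat.find hex2, Nat.find_spec hex2, Nat.find_min' hex2 (hρB.trans hNB),
        fun i hi => not_le.1 (Nat.find_min hex2 hi)⟩
    have hMρ : M ≤ ρ := hρ ▸ le_max_right _ _
    have hsT : T < s := by
      by_contra! h
      have := hMw s h
      linarith
    have hs2 : ‖w s‖ ≤ ρ + 1 := by
      obtain ⟨k, rfl⟩ : ∃ k, s = k + 1 := ⟨s - 1, by omega⟩
      have h1 := hsmin k (by omega)
      have h2 := hstep k
      have h3 := norm_le_norm_add_norm_sub' (w (k + 1)) (w k)
      linarith
    have hN4 : ‖w N‖ ≤ 4 * B := by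
      have h1 := hdist 0 (Nat.zero_le _)
      have h2 := norm_le_norm_add_norm_sub' (w N) z
      have h3 := norm_sub_le (w 0) z
      have h4 := hMw 0 (Nat.zero_le _)
      linarith
    exact aux_geom u z (w s) (w N) hu B M ρ ε δ hzB hNB hN4 (hdir N hNT.le) hρ hs hs2
      (hdir s hsT.le) (hdist s hsN) hM0 hBM hB1 hBε hε hδ hδ1
  rw [← hzdef, dist_eq_norm]
  have h1 : ‖B⁻¹ • z - u‖ ^ 2 < τ ^ 2 := by
    rw [norm_sub_sq_real, norm_smul, inner_smul_left, hu, Real.norm_eq_abs,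
      abs_of_pos (inv_pos.2 hB0)]
    have h2 : B⁻¹ * ‖z‖ ≤ 1 := by
      rw [inv_mul_le_iff₀ hB0]; linarith
    have h3 : 1 - δ ≤ B⁻¹ * inner ℝ z u := by
      rw [le_inv_mul_iff₀ hB0]; linarith
    have h4 : (B⁻¹ * ‖z‖) ^ 2 ≤ 1 := pow_le_one₀ (by positivity) h2
    simp only [conj_trivial]
    linarith
  exact lt_of_pow_lt_pow_left₀ 2 hτ.le h1
end

section
/- For any b > 0, let ℓ be a convex, differentiable, strictly decreasing loss with ℓ(z) = z^{−b} for z ≥ 1. There exist constants c₁, c₂ > 0 and a family of linearly separable datasets, one for each sufficiently large n (namely n points in ℝ² with x_i = (0.1, 0.1) for i < n, x_n = (0.6, −0.8), and all labels y_i = +1), whose maximum margin γ̂ is a universal constant independent of n, while the regularization path with ℓ converges to a direction ū whose margin satisfies c₁ n^{−1/(b+1)} ≤ min_{1≤i≤n} y_i⟨ū, x_i⟩ ≤ c₂ n^{−1/(b+1)}. -/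
open Filter RealInnerProductSpace

lemma aux_bern {b s : ℝ} (hb : 0 < b) (hs : s < 1) : 1 + b * s ≤ (1 - s) ^ (-b) := by
  have h1 : 0 < 1 - s := by linarith
  rw [Real.rpow_def_of_pos h1]
  have h2 := Real.add_one_le_exp (Real.log (1 - s) * -b)
  have h3 := Real.log_le_sub_one_of_pos h1
  nlinarith

lemma aux_bern_lt {b s : ℝ} (hb : 0 < b) (hs : s < 1) (h0 : s ≠ 0) :
    1 + b * s < (1 - s) ^ (-b) := by
  have h1 : 0 < 1 - s := by linarith
  rw [Real.rpow_def_of_pos h1]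
  have h2 := Real.add_one_le_exp (Real.log (1 - s) * -b)
  have h3 := Real.log_lt_sub_one_of_pos h1 (fun h => h0 (by linarith))
  nlinarith

lemma aux_tan {b x c : ℝ} (hb : 0 < b) (hx : 0 < x) (hc : 0 < c) :
    c ^ (-b) * (1 + b * (1 - x / c)) ≤ x ^ (-b) := by
  have h := aux_bern hb (s := 1 - x / c) (by have : 0 < x / c := by positivity
                                             linarith)
  have e : x ^ (-b) = c ^ (-b) * (1 - (1 - x / c)) ^ (-b) := by
    rw [← Real.mul_rpow hc.le (by simp; positivity)]
    congr 1; field_simp; ring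
  rw [e]
  gcongr

lemma aux_tan_lt {b x c : ℝ} (hb : 0 < b) (hx : 0 < x) (hc : 0 < c) (hxc : x ≠ c) :
    c ^ (-b) * (1 + b * (1 - x / c)) < x ^ (-b) := by
  have h := aux_bern_lt hb (s := 1 - x / c) (by have : 0 < x / c := by positivity
                                                linarith)
    (fun h => hxc (by field_simp at h; linarith))
  have e : x ^ (-b) = c ^ (-b) * (1 - (1 - x / c)) ^ (-b) := by
    rw [← Real.mul_rpow hc.le (by simp; positivity)]
    congr 1; field_simp; ring
  rw [e]
  have : 0 < c ^ (-b) := by positivity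
  gcongr

lemma aux_conv {b s t : ℝ} (hb : 0 < b) (hs : 0 < s) (ht : 0 < t) {a c : ℝ} (ha : 0 ≤ a)
    (hc : 0 ≤ c) (hac : a + c = 1) :
    (a * s + c * t) ^ (-b) ≤ a * s ^ (-b) + c * t ^ (-b) := by
  have hz : 0 < a * s + c * t := by
    rcases ha.eq_or_lt with h | h
    · have : c = 1 := by linarith
      subst this; rw [← h]; linarith
    · positivity
  set z := a * s + c * t with hzd
  have h1 := mul_le_mul_of_nonneg_left (aux_tan hb hs hz) ha
  have h2 := mul_le_mul_of_nonneg_left (aux_tan hb ht hz) hc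
  have e : a * (z ^ (-b) * (1 + b * (1 - s / z))) + c * (z ^ (-b) * (1 + b * (1 - t / z)))
      = z ^ (-b) * ((a + c) * (1 + b) - b * ((a * s + c * t) / z)) := by ring
  rw [← hzd, div_self hz.ne', hac] at e
  linarith

lemma aux_sconv {b s t : ℝ} (hb : 0 < b) (hs : 0 < s) (ht : 0 < t) (hst : s ≠ t) :
    ((s + t) / 2) ^ (-b) < (s ^ (-b) + t ^ (-b)) / 2 := by
  have hz : 0 < (s + t) / 2 := by positivity
  set z := (s + t) / 2 with hzd
  have h1 := aux_tan_lt hb hs hz (fun h => hst (by linarith))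
  have h2 := aux_tan hb ht hz
  have e : z ^ (-b) * (1 + b * (1 - s / z)) + z ^ (-b) * (1 + b * (1 - t / z))
      = 2 * (z ^ (-b) * ((1 + b) - b * (((s + t) / 2) / z))) := by ring
  rw [← hzd, div_self hz.ne'] at e
  linarith

def P (v : EuclideanSpace ℝ (Fin 2)) : ℝ := 0.1 * v 0 + 0.1 * v 1
def Q (v : EuclideanSpace ℝ (Fin 2)) : ℝ := 0.6 * v 0 - 0.8 * v 1
lemma P_smul (r : ℝ) (v) : P (r • v) = r * P v := by simp [P]; ring
lemma Q_smul (r : ℝ) (v) : Q (r • v) = r * Q v := by simp [Q]; ring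
lemma P_add (u v) : P (u + v) = P u + P v := by simp [P]; ring
lemma Q_add (u v) : Q (u + v) = Q u + Q v := by simp [Q]; ring
lemma P_inner (v : EuclideanSpace ℝ (Fin 2)) :
    ⟪v, (WithLp.equiv 2 (Fin 2 → ℝ)).symm ![0.1, 0.1]⟫ = P v := by
  simp [P, PiLp.inner_apply, Fin.sum_univ_two]
lemma Q_inner (v : EuclideanSpace ℝ (Fin 2)) :
    ⟪v, (WithLp.equiv 2 (Fin 2 → ℝ)).symm ![0.6, -0.8]⟫ = Q v := by
  simp [Q, PiLp.inner_apply, Fin.sum_univ_two]; ring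
lemma nsq (v : EuclideanSpace ℝ (Fin 2)) : ‖v‖ ^ 2 = v 0 ^ 2 + v 1 ^ 2 := by
  simp [EuclideanSpace.norm_sq_eq, Fin.sum_univ_two]
lemma PQ_inj {u v : EuclideanSpace ℝ (Fin 2)} (h1 : P u = P v) (h2 : Q u = Q v) : u = v := by
  unfold P at h1; unfold Q at h2
  ext i; fin_cases i
  · simp; linarith
  · simp; linarith

noncomputable def G (b m : ℝ) (v : EuclideanSpace ℝ (Fin 2)) : ℝ := m * P v ^ (-b) + Q v ^ (-b)

lemma core {b m : ℝ} (hb : 0 < b) (hm : 1 ≤ m) {ℓ : ℝ → ℝ} (hanti : StrictAnti ℓ)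
    (hℓ : ∀ z : ℝ, 1 ≤ z → ℓ z = z ^ (-b)) (w : ℝ → EuclideanSpace ℝ (Fin 2))
    (hw : ∀ B : ℝ, 0 ≤ B → ‖w B‖ ≤ B ∧ ∀ v, ‖v‖ ≤ B →
      m * ℓ (P (w B)) + ℓ (Q (w B)) ≤ m * ℓ (P v) + ℓ (Q v)) :
    ∃ ubar : EuclideanSpace ℝ (Fin 2), (∀ᶠ B in atTop, B⁻¹ • w B = ubar) ∧ ‖ubar‖ ≤ 1 ∧
      0 < P ubar ∧ 0 < Q ubar ∧
      ∀ u, ‖u‖ ≤ 1 → 0 < P u → 0 < Q u → G b m ubar ≤ G b m u := by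
  have hm0 : 0 < m := by linarith
  have hpos : ∀ z, 0 < ℓ z := by
    intro z
    have h1 : ℓ (max z 1 + 1) < ℓ z := hanti (by linarith [le_max_left z 1])
    have h2 := hℓ (max z 1 + 1) (by linarith [le_max_right z 1])
    have h3 : 0 < (max z 1 + 1) ^ (-b) := Real.rpow_pos_of_pos (by linarith [le_max_right z 1]) _
    linarith
  have hF : ∀ B u, 0 < B → 1 ≤ B * P u → 1 ≤ B * Q u →
      m * ℓ (P (B • u)) + ℓ (Q (B • u)) = B ^ (-b) * G b m u := by
    intro B u hB h1 h2
    have hp : 0 ≤ P u := by by_contra h; nlinarith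
    have hq : 0 ≤ Q u := by by_contra h; nlinarith
    rw [P_smul, Q_smul, hℓ _ h1, hℓ _ h2, Real.mul_rpow hB.le hp, Real.mul_rpow hB.le hq, G]
    ring
  let u0 : EuclideanSpace ℝ (Fin 2) := !₂[0.8, 0.5]
  have hPu0 : P u0 = 0.13 := by simp [P, u0]; norm_num
  have hQu0 : Q u0 = 0.08 := by simp [Q, u0]; norm_num
  have hu0 : ‖u0‖ ≤ 1 := by
    have h1 := nsq u0
    have e0 : u0 0 = 0.8 := by simp [u0]
    have e1 : u0 1 = 0.5 := by simp [u0]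
    rw [e0, e1] at h1
    by_contra h
    nlinarith
  have hG0 : 0 < G b m u0 := by
    rw [G, hPu0, hQu0]; positivity
  set δ : ℝ := (G b m u0) ^ (-(1/b)) with hδ
  have hδ0 : 0 < δ := Real.rpow_pos_of_pos hG0 _
  have hδb : δ ^ (-b) = G b m u0 := by
    rw [hδ, ← Real.rpow_mul hG0.le]
    have : -(1/b) * -b = 1 := by field_simp
    rw [this, Real.rpow_one]
  set B0 : ℝ := max (1/0.08) (1/δ) with hB0
  have hB1 : ∀ B, B0 ≤ B → 0 < B ∧ 1 ≤ B * 0.08 ∧ 1 ≤ B * δ := by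
    intro B hB
    have h1 : 1/0.08 ≤ B := (le_max_left _ _).trans hB
    have h2 : 1/δ ≤ B := (le_max_right _ _).trans hB
    refine ⟨by norm_num at h1; linarith, by norm_num at h1; linarith, ?_⟩
    rwa [div_le_iff₀ hδ0] at h2
  have hA : ∀ B, B0 ≤ B → ‖B⁻¹ • w B‖ ≤ 1 ∧ δ ≤ P (B⁻¹ • w B) ∧ δ ≤ Q (B⁻¹ • w B) ∧
      ∀ u, ‖u‖ ≤ 1 → 1 ≤ B * P u → 1 ≤ B * Q u → G b m (B⁻¹ • w B) ≤ G b m u := by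
    intro B hB
    obtain ⟨hBp, h8, hBδ⟩ := hB1 B hB
    obtain ⟨hw1, hw2⟩ := hw B hBp.le
    have hnorm : ∀ u : EuclideanSpace ℝ (Fin 2), ‖u‖ ≤ 1 → ‖B • u‖ ≤ B := by
      intro u hu
      rw [norm_smul, Real.norm_of_nonneg hBp.le]; nlinarith
    have hwB : w B = B • (B⁻¹ • w B) := by rw [smul_smul, mul_inv_cancel₀ hBp.ne', one_smul]
    have h0 := hw2 (B • u0) (hnorm u0 hu0)
    rw [hF B u0 hBp (by rw [hPu0]; linarith) (by rw [hQu0]; exact h8), ← hδb,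
      ← Real.mul_rpow hBp.le hδ0.le, ← hℓ _ hBδ] at h0
    have hp := hpos (P (w B))
    have hq := hpos (Q (w B))
    have hP : B * δ ≤ P (w B) := by
      rw [← hanti.le_iff_ge]; nlinarith
    have hQ : B * δ ≤ Q (w B) := by
      rw [← hanti.le_iff_ge]; nlinarith
    have hP' : δ ≤ P (B⁻¹ • w B) := by
      rw [P_smul, ← div_eq_inv_mul, le_div_iff₀ hBp]; linarith
    have hQ' : δ ≤ Q (B⁻¹ • w B) := by
      rw [Q_smul, ← div_eq_inv_mul, le_div_iff₀ hBp]; linarith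
    refine ⟨?_, hP', hQ', ?_⟩
    · rw [norm_smul, Real.norm_of_nonneg (inv_nonneg.2 hBp.le), ← div_eq_inv_mul, div_le_one hBp]
      exact hw1
    · intro u hu h1 h2
      have h3 := hw2 (B • u) (hnorm u hu)
      rw [hF B u hBp h1 h2] at h3
      have h4 := hF B (B⁻¹ • w B) hBp (hBδ.trans (by gcongr)) (hBδ.trans (by gcongr))
      rw [← hwB] at h4
      rw [h4] at h3
      exact le_of_mul_le_mul_left h3 (Real.rpow_pos_of_pos hBp _)
  have huniq : ∀ B, B0 ≤ B → B⁻¹ • w B = B0⁻¹ • w B0 := by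
    intro B hB
    obtain ⟨n1, p1, q1, m1⟩ := hA B hB
    obtain ⟨n2, p2, q2, m2⟩ := hA B0 le_rfl
    obtain ⟨hBp, -, hBδ⟩ := hB1 B hB
    obtain ⟨hB0p, -, hB0δ⟩ := hB1 B0 le_rfl
    set u := B⁻¹ • w B
    set v := B0⁻¹ • w B0
    have e1 : G b m u ≤ G b m v := m1 v n2 (hBδ.trans (by gcongr)) (hBδ.trans (by gcongr))
    by_contra hne
    set z := (1/2 : ℝ) • (u + v) with hz
    have zP : P z = (P u + P v) / 2 := by rw [hz, P_smul, P_add]; ring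
    have zQ : Q z = (Q u + Q v) / 2 := by rw [hz, Q_smul, Q_add]; ring
    have zn : ‖z‖ ≤ 1 := by
      rw [hz, norm_smul, Real.norm_of_nonneg (by norm_num)]
      linarith [norm_add_le u v]
    have e2 : G b m v ≤ G b m z := m2 z zn
      (hB0δ.trans (by gcongr; linarith)) (hB0δ.trans (by gcongr; linarith))
    have e3 : G b m u ≤ G b m z := e1.trans e2
    have cP : P z ^ (-b) ≤ (P u ^ (-b) + P v ^ (-b)) / 2 := by
      rw [zP]
      rcases eq_or_ne (P u) (P v) with h | h
      · rw [h]; simp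
      · exact (aux_sconv hb (by linarith) (by linarith) h).le
    have cQ : Q z ^ (-b) ≤ (Q u ^ (-b) + Q v ^ (-b)) / 2 := by
      rw [zQ]
      rcases eq_or_ne (Q u) (Q v) with h | h
      · rw [h]; simp
      · exact (aux_sconv hb (by linarith) (by linarith) h).le
    have : P u ≠ P v ∨ Q u ≠ Q v := by
      by_contra! h
      exact hne (PQ_inj h.1 h.2)
    unfold G at e1 e2 e3
    rcases this with h | h
    · have := aux_sconv hb (by linarith) (by linarith) h
      rw [← zP] at this
      nlinarith
    · have := aux_sconv hb (by linarith) (by linarith) h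
      rw [← zQ] at this
      nlinarith
  obtain ⟨n2, p2, q2, -⟩ := hA B0 le_rfl
  refine ⟨B0⁻¹ • w B0, eventually_atTop.2 ⟨B0, huniq⟩, n2, by linarith, by linarith, ?_⟩
  intro u hu h1 h2
  set B := max B0 (max (1 / P u) (1 / Q u)) with hB
  have hBB : B0 ≤ B := le_max_left _ _
  have g1 : 1 / P u ≤ B := (le_max_left _ _).trans (le_max_right _ _)
  have g2 : 1 / Q u ≤ B := (le_max_right _ _).trans (le_max_right _ _)
  rw [div_le_iff₀ h1] at g1
  rw [div_le_iff₀ h2] at g2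
  rw [← huniq B hBB]
  exact (hA B hBB).2.2.2 u hu g1 g2

/-- from `x ^ (-b) ≤ D * e ^ (-b)` get a lower bound -/
lemma lower_of_rpow {b x D e : ℝ} (hb : 0 < b) (hx : 0 < x) (hD : 0 < D) (he : 0 < e)
    (h : x ^ (-b) ≤ D * e ^ (-b)) : D ^ (-(1/b)) * e ≤ x := by
  have h1 : D = (D ^ (-(1/b))) ^ (-b) := by
    rw [← Real.rpow_mul hD.le]
    have : -(1/b) * -b = 1 := by field_simp
    rw [this, Real.rpow_one]
  have hD' : 0 < D ^ (-(1/b)) := Real.rpow_pos_of_pos hD _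
  rw [h1, ← Real.mul_rpow hD'.le he.le] at h
  exact (Real.rpow_le_rpow_iff_of_neg hx (by positivity) (by linarith)).1 h

lemma estimate {b : ℝ} (hb : 0 < b) : ∃ c₁ c₂ : ℝ, 0 < c₁ ∧ 0 < c₂ ∧
    ∀ (m ε : ℝ) (ub : EuclideanSpace ℝ (Fin 2)), 1 ≤ m → 0 < ε → ε ≤ 1/2 →
      ε ^ (-b) = (m + 1) * ε → ‖ub‖ ≤ 1 → 0 < P ub → 0 < Q ub →
      (∀ u, ‖u‖ ≤ 1 → 0 < P u → 0 < Q u → G b m ub ≤ G b m u) →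
      c₁ * ε ≤ min (P ub) (Q ub) ∧ min (P ub) (Q ub) ≤ c₂ * ε := by
  set A : ℝ := 0.14 ^ (-b) with hA
  set E : ℝ := 0.06 ^ (-b) with hE
  have hA0 : 0 < A := by positivity
  have hE0 : 0 < E := by positivity
  set D := A + 2 * E + 2 with hD
  have hD0 : 0 < D := by positivity
  refine ⟨D ^ (-(1/b)), (2 * E + 2) * 7 / (A * b), by positivity, by positivity, ?_⟩
  intro m ε ub hm hε hε2 hεb hn hP hQ hmin
  have hm0 : 0 < m := by linarith
  let t : EuclideanSpace ℝ (Fin 2) := !₂[0.6 * ε + 0.8 * (1 - ε), -0.8 * ε + 0.6 * (1 - ε)]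
  have tP : P t = (1 - 2 * ε) * 0.14 + (2 * ε) * 0.06 := by simp [P, t]; ring
  have tQ : Q t = ε := by simp [Q, t]; ring
  have tn : ‖t‖ ≤ 1 := by
    have h1 := nsq t
    have e0 : t 0 = 0.6 * ε + 0.8 * (1 - ε) := by simp [t]
    have e1 : t 1 = -0.8 * ε + 0.6 * (1 - ε) := by simp [t]
    rw [e0, e1] at h1
    by_contra h
    nlinarith
  have h := hmin t tn (by rw [tP]; nlinarith) (by rw [tQ]; exact hε)
  have hc := aux_conv hb (s := 0.14) (t := 0.06) (a := 1 - 2 * ε) (c := 2 * ε) (by norm_num)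
    (by norm_num) (by linarith) (by linarith) (by ring)
  rw [← tP, ← hA, ← hE] at hc
  unfold G at h
  rw [tQ, hεb] at h
  have hPQ : P ub ≤ 0.14 * (1 - Q ub / 7) := by
    have h1 : ub 0 ^ 2 + ub 1 ^ 2 ≤ 1 := by
      rw [← nsq]; nlinarith [norm_nonneg ub]
    have h2 : 0.8 * ub 0 + 0.6 * ub 1 ≤ 1 := by
      nlinarith [sq_nonneg (0.6 * ub 0 - 0.8 * ub 1), sq_nonneg (0.8 * ub 0 + 0.6 * ub 1 - 1)]
    simp only [P, Q]; linarith
  have hQ7 : Q ub / 7 < 1 := by by_contra hh; nlinarith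
  have hPl : A * (1 + b * (Q ub / 7)) ≤ P ub ^ (-b) := by
    calc A * (1 + b * (Q ub / 7)) ≤ A * (1 - Q ub / 7) ^ (-b) := by
          gcongr; exact aux_bern hb hQ7
      _ = (0.14 * (1 - Q ub / 7)) ^ (-b) := by
          rw [Real.mul_rpow (by norm_num) (by linarith)]
      _ ≤ P ub ^ (-b) := Real.rpow_le_rpow_of_nonpos hP hPQ (by linarith)
  have hQb : 0 < Q ub ^ (-b) := Real.rpow_pos_of_pos hQ _
  have hPb : 0 < P ub ^ (-b) := Real.rpow_pos_of_pos hP _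
  have hR : m * P t ^ (-b) + (m + 1) * ε ≤ m * (A + (2 * E + 2) * ε) := by
    have : m * P t ^ (-b) ≤ m * (A + 2 * E * ε) := by gcongr; nlinarith
    nlinarith
  have hfin := h.trans hR
  have k1 : P ub ^ (-b) ≤ A + (2 * E + 2) * ε := by
    have : m * P ub ^ (-b) ≤ m * (A + (2 * E + 2) * ε) := by linarith
    exact le_of_mul_le_mul_left this hm0
  constructor
  · apply le_min
    · have := lower_of_rpow hb hP hD0 one_pos (by rw [Real.one_rpow]; nlinarith)
      have hDp : 0 < D ^ (-(1/b)) := by positivity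
      nlinarith
    · apply lower_of_rpow hb hQ hD0 hε
      rw [hεb]
      have h1 : m * A ≤ m * P ub ^ (-b) := by
        gcongr
        have : 0 < A * (b * (Q ub / 7)) := by positivity
        linarith
      have h2 : Q ub ^ (-b) ≤ m * ((2 * E + 2) * ε) := by linarith
      have h3 : m * ((2 * E + 2) * ε) ≤ (m + 1) * (D * ε) := by
        gcongr
        · linarith
        · linarith
      linarith
  · refine (min_le_right _ _).trans ?_
    rw [div_mul_eq_mul_div, le_div_iff₀ (by positivity)]
    linarith

lemma iInf_eq {m : ℕ} (hm : 1 ≤ m) (f : Fin (m + 1) → ℝ) (p q : ℝ)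
    (hp : ∀ i : Fin m, f i.castSucc = p) (hq : f (Fin.last m) = q) : ⨅ i, f i = min p q := by
  apply le_antisymm
  · apply le_min
    · rw [← hp ⟨0, hm⟩]; exact ciInf_le (Set.finite_range f).bddBelow _
    · rw [← hq]; exact ciInf_le (Set.finite_range f).bddBelow _
  · apply le_ciInf
    intro i
    refine Fin.lastCases ?_ (fun j => ?_) i
    · rw [hq]; exact min_le_right _ _
    · rw [hp]; exact min_le_left _ _

lemma margin_le (v : EuclideanSpace ℝ (Fin 2)) (hv : ‖v‖ = 1) :
    min (P v) (Q v) ≤ 1.4 / √106 := by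
  have h1 := nsq v
  rw [hv] at h1
  have hs : 0 < √106 := by positivity
  have hs2 : √106 ^ 2 = 106 := Real.sq_sqrt (by norm_num)
  have h2 : 9 * v 0 + 5 * v 1 ≤ √106 := by
    apply Real.le_sqrt_of_sq_le
    nlinarith [sq_nonneg (5 * v 0 - 9 * v 1)]
  have h3 : min (P v) (Q v) ≤ 1.4 / 106 * (9 * v 0 + 5 * v 1) := by
    have a1 := min_le_left (P v) (Q v)
    have a2 := min_le_right (P v) (Q v)
    have e : (1 - 0.4 / 10.6) * P v + 0.4 / 10.6 * Q v = 1.4 / 106 * (9 * v 0 + 5 * v 1) := by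
      simp only [P, Q]; ring
    rw [← e]
    linarith
  refine h3.trans ?_
  rw [le_div_iff₀ hs]
  nlinarith

noncomputable def ustar : EuclideanSpace ℝ (Fin 2) := !₂[9 / √106, 5 / √106]
lemma ustar_P : P ustar = 1.4 / √106 := by simp [P, ustar]; ring
lemma ustar_Q : Q ustar = 1.4 / √106 := by simp [Q, ustar]; ring
lemma ustar_norm : ‖ustar‖ = 1 := by
  have h := nsq ustar
  have e0 : ustar 0 = 9 / √106 := by simp [ustar]
  have e1 : ustar 1 = 5 / √106 := by simp [ustar]
  rw [e0, e1, div_pow, div_pow, Real.sq_sqrt (by norm_num)] at h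
  norm_num at h
  rcases h with h | h
  · exact h
  · linarith [norm_nonneg ustar]

/-- For any `b > 0` and any convex, differentiable, strictly
decreasing loss with `ℓ(z) = z^{−b}` for `z ≥ 1`, the family of datasets in
`ℝ²` with `n−1` copies of `(0.1, 0.1)`, one point `(0.6, −0.8)`, and all labels
`+1` is linearly separable with a maximum margin `γ̂` independent of `n`, while
for all sufficiently large `n` the regularization path converges to a direction
`ū` whose margin is `Θ(n^{−1/(b+1)})`. -/
theorem polynomial_tail_margin_theta_bound
    (b : ℝ) (hb : 0 < b)
    (ℓ : ℝ → ℝ)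
    (hconv : ConvexOn ℝ Set.univ ℓ)
    (hdiff : Differentiable ℝ ℓ)
    (hanti : StrictAnti ℓ)
    (hℓ : ∀ z : ℝ, 1 ≤ z → ℓ z = z ^ (-b)) :
    ∃ c₁ c₂ γhat : ℝ, 0 < c₁ ∧ 0 < c₂ ∧ 0 < γhat ∧ ∃ N : ℕ, ∀ n : ℕ, N ≤ n →
      ∀ (x : Fin n → EuclideanSpace ℝ (Fin 2)) (y : Fin n → ℝ),
        (∀ i : Fin n,
          ((i : ℕ) + 1 < n → x i = (WithLp.equiv 2 (Fin 2 → ℝ)).symm ![0.1, 0.1]) ∧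
          ((i : ℕ) + 1 = n → x i = (WithLp.equiv 2 (Fin 2 → ℝ)).symm ![0.6, -0.8]) ∧
          y i = 1) →
        (∃ (u : EuclideanSpace ℝ (Fin 2)) (γ : ℝ), ‖u‖ = 1 ∧ 0 < γ ∧
          ∀ i, γ ≤ y i * ⟪u, x i⟫) ∧
        IsGreatest
          {g : ℝ | ∃ v : EuclideanSpace ℝ (Fin 2), ‖v‖ = 1 ∧
            g = ⨅ i, y i * ⟪v, x i⟫} γhat ∧
        ∀ wbar : ℝ → EuclideanSpace ℝ (Fin 2),
          (∀ B : ℝ, 0 ≤ B → ‖wbar B‖ ≤ B ∧ ∀ v, ‖v‖ ≤ B →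
            (1 / (n : ℝ)) * ∑ i, ℓ (y i * ⟪wbar B, x i⟫) ≤
              (1 / (n : ℝ)) * ∑ i, ℓ (y i * ⟪v, x i⟫)) →
          ∃ ubar : EuclideanSpace ℝ (Fin 2),
            Tendsto (fun B : ℝ => B⁻¹ • wbar B) atTop (nhds ubar) ∧
            c₁ * (n : ℝ) ^ (-(1 / (b + 1))) ≤ (⨅ i, y i * ⟪ubar, x i⟫) ∧
            (⨅ i, y i * ⟪ubar, x i⟫) ≤ c₂ * (n : ℝ) ^ (-(1 / (b + 1))) := by
  obtain ⟨c₁, c₂, hc1, hc2, hest⟩ := estimate hb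
  obtain ⟨N0, hN0⟩ := exists_nat_ge ((2:ℝ) ^ (b + 1))
  refine ⟨c₁, c₂, 1.4 / √106, hc1, hc2, by positivity, max N0 2, ?_⟩
  intro n hn x y hxy
  have hn2 : 2 ≤ n := (le_max_right _ _).trans hn
  have hnN : N0 ≤ n := (le_max_left _ _).trans hn
  obtain ⟨m, rfl⟩ : ∃ m, n = m + 1 := ⟨n - 1, by omega⟩
  have hm : 1 ≤ m := by omega
  have hp : ∀ v, ∀ i : Fin m, y i.castSucc * ⟪v, x i.castSucc⟫ = P v := by
    intro v i
    obtain ⟨h1, -, h3⟩ := hxy i.castSucc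
    rw [h3, h1 (by simp), P_inner, one_mul]
  have hq : ∀ v, y (Fin.last m) * ⟪v, x (Fin.last m)⟫ = Q v := by
    intro v
    obtain ⟨-, h1, h3⟩ := hxy (Fin.last m)
    rw [h3, h1 (by simp), Q_inner, one_mul]
  have hinf : ∀ v, ⨅ i, y i * ⟪v, x i⟫ = min (P v) (Q v) := fun v =>
    iInf_eq hm (fun i => y i * ⟪v, x i⟫) _ _ (hp v) (hq v)
  have hsum : ∀ v, ∑ i, ℓ (y i * ⟪v, x i⟫) = m * ℓ (P v) + ℓ (Q v) := by
    intro v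
    rw [Fin.sum_univ_castSucc, hq]
    simp [hp]
  refine ⟨⟨ustar, 1.4 / √106, ustar_norm, by positivity, ?_⟩, ⟨⟨ustar, ustar_norm, ?_⟩, ?_⟩, ?_⟩
  · intro i
    refine Fin.lastCases ?_ (fun j => ?_) i
    · rw [hq, ustar_Q]
    · rw [hp, ustar_P]
  · rw [hinf, ustar_P, ustar_Q, min_self]
  · rintro g ⟨v, hv, rfl⟩
    rw [hinf]
    exact margin_le v hv
  · intro w hw
    have hm1 : (1 : ℝ) ≤ m := by exact_mod_cast hm
    obtain ⟨ub, hev, hn1, hP, hQ, hmin⟩ := core (m := m) hb hm1 hanti hℓ w (by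
      intro B hB
      refine ⟨(hw B hB).1, fun v hv => ?_⟩
      have h := (hw B hB).2 v hv
      rw [hsum, hsum] at h
      exact le_of_mul_le_mul_left h (by positivity))
    refine ⟨ub, tendsto_const_nhds.congr' (hev.mono fun B h => h.symm), ?_⟩
    rw [hinf]
    have hnp : (0 : ℝ) < ((m + 1 : ℕ) : ℝ) := by positivity
    refine hest m _ ub hm1 (Real.rpow_pos_of_pos hnp _) ?_ ?_ hn1 hP hQ hmin
    · have h1 : (2:ℝ) ^ (b + 1) ≤ ((m + 1 : ℕ) : ℝ) := hN0.trans (by exact_mod_cast hnN)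
      have h2 := Real.rpow_le_rpow_of_nonpos (by positivity) h1
        (z := -(1 / (b + 1))) (by
          have : 0 < 1 / (b + 1) := by positivity
          linarith)
      refine h2.trans (le_of_eq ?_)
      rw [← Real.rpow_mul (by norm_num)]
      have : (b + 1) * -(1 / (b + 1)) = -1 := by field_simp
      rw [this, Real.rpow_neg_one]; norm_num
    · have e : ((m : ℝ) + 1) = ((m + 1 : ℕ) : ℝ) := by push_cast; rfl
      rw [e, ← Real.rpow_mul hnp.le]
      nth_rewrite 2 [← Real.rpow_one ((m + 1 : ℕ) : ℝ)]
      rw [← Real.rpow_add hnp]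
      congr 1
      field_simp
      ring
end

section
/- Suppose ℓ is twice continuously differentiable with ℓ'' > 0, the step size satisfies η ≤ 1/(2R(w_0)) and R(w_{t+1}) − R(w_t) ≤ −(η/2)‖∇R(w_t)‖² for all t, and D_c ≠ ∅. Then lim_{t→∞} ‖w_t‖ = lim_{B→∞} ‖w̄(B)‖ = ∞; moreover lim_{t→∞} w_t/‖w_t‖ exists if and only if lim_{B→∞} w̄(B)/B exists, and when they exist they are equal and lie in S^⊥. -/
open Filter RealInnerProductSpace
open scoped Classical

section aux
variable {E : Type*} [NormedAddCommGroup E] [InnerProductSpace ℝ E]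

lemma aux_dir {ι : Type*} {l : Filter ι} (v : ι → E) (u : E) (hu : ‖u‖ = 1)
    (hpos : ∀ᶠ i in l, 0 < ‖v i‖)
    (h : ∀ ε : ℝ, 0 < ε → ε < 1 → ∀ᶠ i in l, (1 - 3 * ε) * ‖v i‖ ≤ ⟪v i, u⟫) :
    Tendsto (fun i => ‖v i‖⁻¹ • v i) l (nhds u) := by
  rw [Metric.tendsto_nhds]
  intro r hr
  set ε := min (1/2) (r^2/12) with hε
  have h0 : 0 < ε := by positivity
  have h1 : ε < 1 := lt_of_le_of_lt (min_le_left _ _) (by norm_num)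
  have h2 : ε ≤ r^2/12 := min_le_right _ _
  filter_upwards [hpos, h ε h0 h1] with i hi hi2
  rw [dist_eq_norm]
  have e1 : ‖‖v i‖⁻¹ • v i - u‖^2 = 2 - 2 * (‖v i‖⁻¹ * ⟪v i, u⟫) := by
    rw [norm_sub_sq_real, inner_smul_left, hu, norm_smul, norm_inv, norm_norm,
      inv_mul_cancel₀ hi.ne']
    simp
    ring
  have e2 : 1 - 3 * ε ≤ ‖v i‖⁻¹ * ⟪v i, u⟫ := by
    rw [inv_mul_eq_div, le_div_iff₀ hi]; exact hi2
  have : ‖‖v i‖⁻¹ • v i - u‖^2 < r^2 := by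
    rw [e1]; nlinarith [pow_pos hr 2]
  exact lt_of_pow_lt_pow_left₀ 2 hr.le this

lemma aux_ivt (f : ℕ → ℝ) (K c : ℝ) (hf : ∀ t, f (t+1) ≤ f t + K) (h0 : f 0 ≤ c) :
    ∀ t, c < f t → ∃ s < t, c - K ≤ f s ∧ f s ≤ c := by
  intro t
  induction t with
  | zero => intro h; linarith
  | succ t ih =>
    intro h
    by_cases hc : c < f t
    · obtain ⟨s, hs, h⟩ := ih hc
      exact ⟨s, by omega, h⟩
    · exact ⟨t, by omega, by linarith [hf t], by linarith⟩

/-- Quantitative form of convergence in direction, with an additive constant. -/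
lemma aux_const (v : ℕ → E) (u : E) (hpos : ∀ᶠ i in atTop, 0 < ‖v i‖)
    (h : Tendsto (fun i => ‖v i‖⁻¹ • v i) atTop (nhds u)) (δ : ℝ) (hδ : 0 < δ) :
    ∃ C : ℝ, 0 ≤ C ∧ ∀ i, ‖v i - ‖v i‖ • u‖ ≤ δ * ‖v i‖ + C := by
  have h1 := (Metric.tendsto_nhds.1 h) δ hδ
  obtain ⟨T, hT⟩ := eventually_atTop.1 (h1.and hpos)
  refine ⟨∑ i ∈ Finset.range T, ‖v i - ‖v i‖ • u‖, Finset.sum_nonneg fun _ _ => norm_nonneg _, ?_⟩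
  intro i
  by_cases hi : i < T
  · have := Finset.single_le_sum (f := fun i => ‖v i - ‖v i‖ • u‖)
      (fun _ _ => norm_nonneg _) (Finset.mem_range.2 hi)
    have h2 : 0 ≤ δ * ‖v i‖ := by positivity
    linarith
  · obtain ⟨a, b⟩ := hT i (by omega)
    have e : v i - ‖v i‖ • u = ‖v i‖ • (‖v i‖⁻¹ • v i - u) := by
      rw [smul_sub, smul_smul, mul_inv_cancel₀ b.ne', one_smul]
    rw [e, norm_smul, norm_norm]
    rw [dist_eq_norm] at a
    have h3 : 0 ≤ ∑ i ∈ Finset.range T, ‖v i - ‖v i‖ • u‖ :=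
      Finset.sum_nonneg fun _ _ => norm_nonneg _
    nlinarith

variable (R : E → ℝ) (g : E → E) (η : ℝ) (w : ℕ → E) (wbar : ℝ → E) (e : E)

lemma aux_step (hη : 0 < η) (hgrad : ∀ a z, R a + ⟪g a, z - a⟫ ≤ R z)
    (hgd : ∀ t, w (t+1) = w t - η • g (w t))
    (hdesc : ∀ t, R (w (t+1)) - R (w t) ≤ -(η/2) * ‖g (w t)‖^2) (z : E) (t : ℕ) :
    ‖w (t+1) - z‖^2 ≤ ‖w t - z‖^2 + 2 * η * (R z - R (w (t+1))) := by
  have h1 := hgrad (w t) z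
  have h2 := hdesc t
  have e1 : w (t+1) - z = (w t - z) - η • g (w t) := by rw [hgd]; abel
  have e2 : ⟪g (w t), z - w t⟫ = - ⟪w t - z, g (w t)⟫ := by
    rw [real_inner_comm, ← inner_neg_left]; simp
  rw [e1, norm_sub_sq_real, inner_smul_right, norm_smul, Real.norm_of_nonneg hη.le]
  rw [e2] at h1
  nlinarith

lemma aux_mono (hη : 0 < η)
    (hdesc : ∀ t, R (w (t+1)) - R (w t) ≤ -(η/2) * ‖g (w t)‖^2) : Antitone (fun t => R (w t)) := by
  apply antitone_nat_of_succ_le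
  intro t
  have : 0 ≤ (η/2) * ‖g (w t)‖^2 := by positivity
  linarith [hdesc t]

lemma aux_B (hη : 0 < η) (hgrad : ∀ a z, R a + ⟪g a, z - a⟫ ≤ R z)
    (hgd : ∀ t, w (t+1) = w t - η • g (w t))
    (hdesc : ∀ t, R (w (t+1)) - R (w t) ≤ -(η/2) * ‖g (w t)‖^2) (z : E) (s t : ℕ)
    (hst : s ≤ t) : R z ≤ R (w t) → ‖w t‖^2 - ‖w s‖^2 ≤ 2 * ⟪w t - w s, z⟫ := by
  have key : R z ≤ R (w t) → ‖w t - z‖^2 ≤ ‖w s - z‖^2 := by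
    induction t, hst using Nat.le_induction with
    | base => intro _; exact le_rfl
    | succ t hst ih =>
      intro h
      have h1 := aux_step R g η w hη hgrad hgd hdesc z t
      have h2 := aux_mono R g η w hη hdesc (Nat.le_succ t)
      simp only [Nat.succ_eq_add_one] at h2
      have h3 := ih (by linarith)
      nlinarith
  intro h
  have := key h
  rw [norm_sub_sq_real, norm_sub_sq_real] at this
  rw [inner_sub_left]; linarith

lemma aux_C (hη : 0 < η) (hgrad : ∀ a z, R a + ⟪g a, z - a⟫ ≤ R z)
    (hgd : ∀ t, w (t+1) = w t - η • g (w t))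
    (hdesc : ∀ t, R (w (t+1)) - R (w t) ≤ -(η/2) * ‖g (w t)‖^2)
    (he : ∀ a, ∀ r : ℝ, 0 < r → R (a + r • e) < R a) (z : E) :
    ∀ᶠ t in atTop, R (w t) < R z := by
  have hm := aux_mono R g η w hη hdesc
  by_contra hc
  have hall : ∀ t, R z ≤ R (w t) := by
    intro t
    by_contra hlt
    push Not at hlt
    exact hc (eventually_atTop.2 ⟨t, fun s hs => lt_of_le_of_lt (hm hs) hlt⟩)
  set z' := z + (1:ℝ) • e with hz'
  have hlt : R z' < R z := he z 1 one_pos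
  have hb : ∀ t : ℕ, ‖w t - z'‖^2 ≤ ‖w 0 - z'‖^2 - t * (2 * η * (R z - R z')) := by
    intro t
    induction t with
    | zero => simp
    | succ t ih =>
      have h1 := aux_step R g η w hη hgrad hgd hdesc z' t
      have h2 : 2 * η * R z ≤ 2 * η * R (w (t+1)) :=
        mul_le_mul_of_nonneg_left (hall (t+1)) (by positivity)
      push_cast
      linarith
  have hp : 0 < 2 * η * (R z - R z') := by
    have : 0 < R z - R z' := by linarith
    positivity
  obtain ⟨N, hN⟩ := exists_nat_gt (‖w 0 - z'‖^2 / (2 * η * (R z - R z')))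
  rw [div_lt_iff₀ hp] at hN
  linarith [hb N, sq_nonneg ‖w N - z'‖]

lemma aux_wbar (he1 : ‖e‖ = 1) (he : ∀ a, ∀ r : ℝ, 0 < r → R (a + r • e) < R a)
    (hwbar : ∀ B : ℝ, 0 ≤ B → ‖wbar B‖ ≤ B ∧ ∀ v, ‖v‖ ≤ B → R (wbar B) ≤ R v)
    (B : ℝ) (hB : 0 ≤ B) : ‖wbar B‖ = B := by
  obtain ⟨h1, h2⟩ := hwbar B hB
  by_contra hne
  have hlt : ‖wbar B‖ < B := lt_of_le_of_ne h1 hne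
  have h3 := he (wbar B) (B - ‖wbar B‖) (by linarith)
  have h4 := h2 (wbar B + (B - ‖wbar B‖) • e) (by
    refine (norm_add_le _ _).trans ?_
    rw [norm_smul, he1, Real.norm_of_nonneg (by linarith)]; linarith)
  linarith

lemma aux_inf (hη : 0 < η) (hgrad : ∀ a z, R a + ⟪g a, z - a⟫ ≤ R z)
    (hgd : ∀ t, w (t+1) = w t - η • g (w t))
    (hdesc : ∀ t, R (w (t+1)) - R (w t) ≤ -(η/2) * ‖g (w t)‖^2)
    (he : ∀ a, ∀ r : ℝ, 0 < r → R (a + r • e) < R a)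
    (hwbar : ∀ B : ℝ, 0 ≤ B → ‖wbar B‖ ≤ B ∧ ∀ v, ‖v‖ ≤ B → R (wbar B) ≤ R v) :
    Tendsto (fun t => ‖w t‖) atTop atTop := by
  rw [tendsto_atTop]
  intro M
  filter_upwards [aux_C R g η w e hη hgrad hgd hdesc he (wbar |M|)] with t ht
  by_contra hc
  push Not at hc
  have := (hwbar |M| (abs_nonneg _)).2 (w t) (hc.le.trans (le_abs_self _))
  linarith

lemma aux_bdd (hη : 0 < η) (hR0 : ∀ a, 0 ≤ R a)
    (hgd : ∀ t, w (t+1) = w t - η • g (w t))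
    (hdesc : ∀ t, R (w (t+1)) - R (w t) ≤ -(η/2) * ‖g (w t)‖^2) :
    ∃ K : ℝ, 0 ≤ K ∧ ∀ t, ‖w (t+1)‖ ≤ ‖w t‖ + K := by
  refine ⟨√(2 * η * R (w 0)), Real.sqrt_nonneg _, fun t => ?_⟩
  have h1 : ‖η • g (w t)‖ ≤ √(2 * η * R (w 0)) := by
    apply Real.le_sqrt_of_sq_le
    rw [norm_smul, Real.norm_of_nonneg hη.le]
    have h2 := aux_mono R g η w hη hdesc (Nat.zero_le t)
    simp only at h2
    have h3 : (η/2) * ‖g (w t)‖^2 ≤ R (w 0) := by linarith [hdesc t, hR0 (w (t+1))]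
    nlinarith
  rw [hgd]
  exact (norm_sub_le _ _).trans (by linarith)

lemma aux_forward (hη : 0 < η) (hR0 : ∀ a, 0 ≤ R a) (hgrad : ∀ a z, R a + ⟪g a, z - a⟫ ≤ R z)
    (hgd : ∀ t, w (t+1) = w t - η • g (w t))
    (hdesc : ∀ t, R (w (t+1)) - R (w t) ≤ -(η/2) * ‖g (w t)‖^2)
    (he1 : ‖e‖ = 1) (he : ∀ a, ∀ r : ℝ, 0 < r → R (a + r • e) < R a)
    (hwbar : ∀ B : ℝ, 0 ≤ B → ‖wbar B‖ ≤ B ∧ ∀ v, ‖v‖ ≤ B → R (wbar B) ≤ R v)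
    (u : E) (hu : Tendsto (fun B : ℝ => B⁻¹ • wbar B) atTop (nhds u)) (hu1 : ‖u‖ = 1) :
    Tendsto (fun t : ℕ => ‖w t‖⁻¹ • w t) atTop (nhds u) := by
  have hinf := aux_inf R g η w wbar e hη hgrad hgd hdesc he hwbar
  obtain ⟨K, hK0, hK⟩ := aux_bdd R g η w hη hR0 hgd hdesc
  apply aux_dir w u hu1 (hinf.eventually_gt_atTop 0)
  intro ε h0 h1
  have hδ : 0 < ε^2/2 := by positivity
  obtain ⟨N1, hN1⟩ := eventually_atTop.1 ((Metric.tendsto_nhds.1 hu) (ε^2/2) hδ)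
  -- threshold
  obtain ⟨N, hNpos, hNN1, hNK, hNw⟩ : ∃ N : ℝ, 0 < N ∧ N1 ≤ N ∧ K ≤ ε * N ∧ ‖w 0‖ ≤ (1-ε) * N := by
    have : ∀ᶠ N : ℝ in atTop, 0 < N ∧ N1 ≤ N ∧ K / ε ≤ N ∧ ‖w 0‖ / (1-ε) ≤ N := by
      filter_upwards [eventually_gt_atTop 0, eventually_ge_atTop N1, eventually_ge_atTop (K/ε),
        eventually_ge_atTop (‖w 0‖/(1-ε))] with N a b c d using ⟨a, b, c, d⟩
    obtain ⟨N, a, b, c, d⟩ := this.exists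
    rw [div_le_iff₀ h0] at c
    rw [div_le_iff₀ (by linarith)] at d
    exact ⟨N, a, b, by linarith, by linarith⟩
  have key : ∀ t, (1 - 2 * ε) * ‖w t‖ - 2 * N ≤ ⟪w t, u⟫ := by
    intro t
    induction t using Nat.strong_induction_on with
    | _ t ih =>
      have hcs : -‖w t‖ ≤ ⟪w t, u⟫ := by
        have := abs_le.1 (abs_real_inner_le_norm (w t) u)
        rw [hu1, mul_one] at this; exact this.1
      by_cases hb : ‖w t‖ ≤ N
      · nlinarith [norm_nonneg (w t)]
      · push Not at hb
        set b := ‖w t‖ with hbdef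
        have hbpos : 0 < b := hNpos.trans hb
        obtain ⟨s, hst, hs1, hs2⟩ := aux_ivt (fun t => ‖w t‖) K ((1-ε) * b) hK
          (by nlinarith) t (by nlinarith)
        have ihs := ih s hst
        set a := ‖w s‖ with hadef
        have ha0 : 0 ≤ a := norm_nonneg _
        have hB := aux_B R g η w hη hgrad hgd hdesc (wbar b) s t hst.le
          ((hwbar b hbpos.le).2 (w t) le_rfl)
        rw [← hbdef, ← hadef] at hB
        have hz : ‖wbar b - b • u‖ ≤ ε^2/2 * b := by
          have h3 := hN1 b (by linarith)
          rw [dist_eq_norm] at h3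
          have e : wbar b - b • u = b • (b⁻¹ • wbar b - u) := by
            rw [smul_sub, smul_smul, mul_inv_cancel₀ hbpos.ne', one_smul]
          rw [e, norm_smul, Real.norm_of_nonneg hbpos.le]
          nlinarith
        have hin : ⟪w t - w s, wbar b⟫ ≤ b * (⟪w t, u⟫ - ⟪w s, u⟫) + (b + a) * (ε^2/2 * b) := by
          have e : wbar b = b • u + (wbar b - b • u) := by abel
          rw [e, inner_add_right, inner_smul_right, inner_sub_left]
          have h4 : ⟪w t - w s, wbar b - b • u⟫ ≤ (b + a) * (ε^2/2 * b) :=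
            (real_inner_le_norm _ _).trans
              (mul_le_mul (norm_sub_le _ _) hz (norm_nonneg _) (by positivity))
          linarith
        have hab : a ≤ b := by nlinarith
        have ha2 : (1 - 2 * ε) * b ≤ a := by nlinarith
        -- divide by b
        have h5 : (b + a) * (ε^2/2 * b) ≤ b * (ε * (b - a)) := by
          have h6 : (b + a) * (ε^2/2 * b) ≤ (2 * b) * (ε^2/2*b) :=
            mul_le_mul_of_nonneg_right (by linarith) (by positivity)
          have h7 : b * (ε * (ε * b)) ≤ b * (ε * (b - a)) := by
            apply mul_le_mul_of_nonneg_left _ hbpos.le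
            apply mul_le_mul_of_nonneg_left _ h0.le
            linarith
          nlinarith
        have h8 : b * (2 * (1 - ε) * (b - a)) ≤ b^2 - a^2 := by
          nlinarith [mul_nonneg (sub_nonneg.2 hab) (sub_nonneg.2 ha2)]
        have h9 : b * ((1 - ε) * (b - a)) ≤ b * ((⟪w t, u⟫ - ⟪w s, u⟫) + ε * (b - a)) := by
          nlinarith
        have h10 := le_of_mul_le_mul_left h9 hbpos
        linarith
  filter_upwards [hinf.eventually_ge_atTop (2 * N / ε)] with t ht
  rw [div_le_iff₀ h0] at ht
  linarith [key t]

set_option maxHeartbeats 1000000 in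
lemma aux_backward (hη : 0 < η) (hR0 : ∀ a, 0 ≤ R a) (hgrad : ∀ a z, R a + ⟪g a, z - a⟫ ≤ R z)
    (hgd : ∀ t, w (t+1) = w t - η • g (w t))
    (hdesc : ∀ t, R (w (t+1)) - R (w t) ≤ -(η/2) * ‖g (w t)‖^2)
    (he1 : ‖e‖ = 1) (he : ∀ a, ∀ r : ℝ, 0 < r → R (a + r • e) < R a)
    (hwbar : ∀ B : ℝ, 0 ≤ B → ‖wbar B‖ ≤ B ∧ ∀ v, ‖v‖ ≤ B → R (wbar B) ≤ R v)
    (u : E) (hu : Tendsto (fun t : ℕ => ‖w t‖⁻¹ • w t) atTop (nhds u)) (hu1 : ‖u‖ = 1) :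
    Tendsto (fun B : ℝ => B⁻¹ • wbar B) atTop (nhds u) := by
  have hinf := aux_inf R g η w wbar e hη hgrad hgd hdesc he hwbar
  have hwb := aux_wbar R wbar e he1 he hwbar
  obtain ⟨K, hK0, hK⟩ := aux_bdd R g η w hη hR0 hgd hdesc
  have main : Tendsto (fun B : ℝ => ‖wbar B‖⁻¹ • wbar B) atTop (nhds u) := by
    apply aux_dir wbar u hu1
    · filter_upwards [eventually_gt_atTop 0] with B hB
      rw [hwb B hB.le]; exact hB
    intro ε h0 h1
    have hδ : 0 < ε^2/4 := by positivity
    obtain ⟨C, hC0, hC⟩ := aux_const w u (hinf.eventually_gt_atTop 0) hu (ε^2/4) hδ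
    filter_upwards [eventually_gt_atTop 0, eventually_ge_atTop ‖w 0‖, eventually_ge_atTop (K/ε),
      eventually_ge_atTop (K / ε + K), eventually_ge_atTop (‖w 0‖/(1-ε) + K),
      eventually_gt_atTop K, eventually_ge_atTop (C / (ε^2/4) + K)]
      with B hB hBw hBK hBK2 hBw2 hBK3 hBC
    rw [hwb B hB.le]
    have hex := (aux_C R g η w e hη hgrad hgd hdesc he (wbar B)).exists
    have hT := Nat.find_spec hex
    have hTm := fun m => Nat.find_min hex (m := m)
    set T := Nat.find hex
    have hT0 : T ≠ 0 := by
      intro h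
      rw [h] at hT
      linarith [(hwbar B hB.le).2 (w 0) hBw]
    obtain ⟨t, ht⟩ := Nat.exists_eq_succ_of_ne_zero hT0
    have hRt : R (wbar B) ≤ R (w t) := by
      have := hTm t (by omega); push Not at this; exact this
    have hbig : B ≤ ‖w (t+1)‖ := by
      by_contra hc
      push Not at hc
      rw [ht] at hT
      have := (hwbar B hB.le).2 (w (t+1)) hc.le
      simp only [Nat.succ_eq_add_one] at hT
      linarith
    have hbB : B - K ≤ ‖w t‖ := by linarith [hK t]
    have hCt := hC t
    set b := ‖w t‖ with hbdef
    have hbpos : 0 < b := by linarith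
    have hb1 : K ≤ ε * b := by
      have : K / ε ≤ b := by linarith
      rw [div_le_iff₀ h0] at this; linarith
    have hb2 : ‖w 0‖ ≤ (1 - ε) * b := by
      have : ‖w 0‖/(1-ε) ≤ b := by linarith
      rw [div_le_iff₀ (by linarith)] at this; linarith
    have hb3 : C ≤ ε^2/4 * b := by
      have : C/(ε^2/4) ≤ b := by linarith
      rw [div_le_iff₀ hδ] at this; linarith
    obtain ⟨s, hst, hs1, hs2⟩ := aux_ivt (fun t => ‖w t‖) K ((1-ε) * b) hK hb2 t
      (by nlinarith)
    have hCs := hC s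
    set a := ‖w s‖ with hadef
    have ha0 : 0 ≤ a := norm_nonneg _
    have hBB := aux_B R g η w hη hgrad hgd hdesc (wbar B) s t hst.le hRt
    rw [← hbdef, ← hadef] at hBB
    have hab : a ≤ b := by nlinarith
    have ha2 : (1 - 2 * ε) * b ≤ a := by nlinarith
    have hin : ⟪w t - w s, wbar B⟫ ≤ (b - a) * ⟪wbar B, u⟫ + (ε^2 * b) * B := by
      have e : w t - w s = (b - a) • u + ((w t - b • u) - (w s - a • u)) := by
        rw [sub_smul]; abel
      rw [e, inner_add_left, inner_smul_left, real_inner_comm]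
      have h4 : ⟪(w t - b • u) - (w s - a • u), wbar B⟫ ≤ (ε^2 * b) * B := by
        refine (real_inner_le_norm _ _).trans ?_
        rw [hwb B hB.le]
        apply mul_le_mul_of_nonneg_right _ hB.le
        refine (norm_sub_le _ _).trans ?_
        have : ε^2/4 * a ≤ ε^2/4 * b := mul_le_mul_of_nonneg_left hab hδ.le
        linarith
      simp only [conj_trivial]
      linarith
    set q := ⟪wbar B, u⟫
    have hba : 0 < b - a := by nlinarith
    have h5 : (ε^2 * b) * B ≤ (b - a) * (ε * B) := by
      have : ε * b ≤ b - a := by linarith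
      have := mul_le_mul_of_nonneg_right this (by positivity : 0 ≤ ε * B)
      linarith
    have h6 : (b - a) * (b + a) ≤ (b - a) * (2 * q + 2 * (ε * B)) := by nlinarith
    have h7 := le_of_mul_le_mul_left h6 hba
    have h8 : K ≤ ε * B := by rw [div_le_iff₀ h0] at hBK; linarith
    have h9 : (1 - ε) * ((1 - ε) * B) ≤ (1 - ε) * b :=
      mul_le_mul_of_nonneg_left (by linarith) (by linarith)
    have h10 : 0 < ε ^ 2 * B := mul_pos (pow_pos h0 2) hB
    clear_value q a b
    linarith
  refine main.congr' ?_
  filter_upwards [eventually_ge_atTop 0] with B hB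
  rw [hwb B hB]

end aux

/-- A convex differentiable function lies above its tangents. -/
lemma aux_tangent (ℓ : ℝ → ℝ) (hconv : ConvexOn ℝ Set.univ ℓ) (hd : Differentiable ℝ ℓ) (a b : ℝ) :
    ℓ a + deriv ℓ a * (b - a) ≤ ℓ b := by
  rcases lt_trichotomy a b with h | h | h
  · have := hconv.deriv_le_slope (Set.mem_univ a) (Set.mem_univ b) h (hd a)
    rw [slope_def_field, le_div_iff₀ (by linarith)] at this
    linarith
  · subst h; simp
  · have := hconv.slope_le_deriv (Set.mem_univ b) (Set.mem_univ a) h (hd a)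
    rw [slope_def_field, div_le_iff₀ (by linarith)] at this
    linarith

/-- For a twice continuously differentiable loss with
`ℓ'' > 0`, an admissible step size, and a nonempty separable part `D_c`, the
norms of both the gradient-descent iterates and the regularized solutions tend
to infinity; moreover the gradient-descent direction converges iff the
regularization-path direction converges, and when both exist they are equal
and lie in `S^⊥`. -/
theorem general_data_direction_equivalence
    {d n : ℕ} (hn : 0 < n)
    (x : Fin n → EuclideanSpace ℝ (Fin d)) (y : Fin n → ℝ)
    (hx : ∀ i, ‖x i‖ ≤ 1) (hy : ∀ i, y i = 1 ∨ y i = -1)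
    (ℓ : ℝ → ℝ)
    (hconv : ConvexOn ℝ Set.univ ℓ)
    (hanti : StrictAnti ℓ)
    (hlim0 : Tendsto ℓ atTop (nhds 0))
    (hC2 : ContDiff ℝ 2 ℓ)
    (hℓ'' : ∀ z : ℝ, 0 < deriv (deriv ℓ) z)
    (R : EuclideanSpace ℝ (Fin d) → ℝ)
    (hR : R = fun w => (1 / (n : ℝ)) * ∑ i, ℓ (y i * ⟪w, x i⟫))
    (InC : Fin n → Prop)
    (hInC : ∀ i, InC i ↔ ∃ u : EuclideanSpace ℝ (Fin d), ‖u‖ = 1 ∧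
      0 < y i * ⟪u, x i⟫ ∧ ∀ j, 0 ≤ y j * ⟪u, x j⟫)
    (hDc : ∃ i, InC i)
    (S : Submodule ℝ (EuclideanSpace ℝ (Fin d)))
    (hS : S = Submodule.span ℝ {v | ∃ i, ¬ InC i ∧ x i = v})
    (η : ℝ) (hη : 0 < η)
    (w : ℕ → EuclideanSpace ℝ (Fin d))
    (hgd : ∀ t : ℕ, w (t + 1) = w t - η • gradient R (w t))
    (hη2 : η ≤ 1 / (2 * R (w 0)))
    (hdesc : ∀ t : ℕ, R (w (t + 1)) - R (w t) ≤ -(η / 2) * ‖gradient R (w t)‖ ^ 2)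
    (wbar : ℝ → EuclideanSpace ℝ (Fin d))
    (hwbar : ∀ B : ℝ, 0 ≤ B → ‖wbar B‖ ≤ B ∧ ∀ v, ‖v‖ ≤ B → R (wbar B) ≤ R v) :
    Tendsto (fun t : ℕ => ‖w t‖) atTop atTop ∧
    Tendsto (fun B : ℝ => ‖wbar B‖) atTop atTop ∧
    ((∃ u, Tendsto (fun t : ℕ => ‖w t‖⁻¹ • w t) atTop (nhds u)) ↔
      (∃ u, Tendsto (fun B : ℝ => B⁻¹ • wbar B) atTop (nhds u))) ∧
    (∀ u u' : EuclideanSpace ℝ (Fin d),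
      Tendsto (fun t : ℕ => ‖w t‖⁻¹ • w t) atTop (nhds u) →
      Tendsto (fun B : ℝ => B⁻¹ • wbar B) atTop (nhds u') →
      u = u' ∧ u ∈ Sᗮ) := by

  have hd : Differentiable ℝ ℓ := hC2.differentiable (by norm_num)
  have hn' : (0:ℝ) < n := by exact_mod_cast hn
  have hpos : ∀ z, 0 < ℓ z := by
    intro z
    have h1 : 0 ≤ ℓ (z+1) := hanti.antitone.le_of_tendsto hlim0 (z+1)
    linarith [hanti (lt_add_one z)]
  have hR0 : ∀ a, 0 ≤ R a := by
    intro a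
    rw [hR]
    have : 0 ≤ ∑ i, ℓ (y i * ⟪a, x i⟫) := Finset.sum_nonneg fun i _ => (hpos _).le
    simp only
    positivity
  have hgradR : ∀ a, HasGradientAt R ((1 / (n : ℝ)) • ∑ i, (deriv ℓ (y i * ⟪a, x i⟫) * y i) • x i) a := by
    intro a
    rw [hasGradientAt_iff_hasFDerivAt, hR]
    have h1 : ∀ i, HasFDerivAt (fun v : EuclideanSpace ℝ (Fin d) => ℓ (y i * ⟪v, x i⟫))
        (deriv ℓ (y i * ⟪a, x i⟫) • (y i • (innerSL ℝ (x i)))) a := by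
      intro i
      have h2 : HasFDerivAt (fun v : EuclideanSpace ℝ (Fin d) => y i * ⟪v, x i⟫)
          (y i • (innerSL ℝ (x i))) a := by
        have := ((innerSL ℝ (x i)).hasFDerivAt (x := a)).const_mul (y i)
        simpa [real_inner_comm] using this
      exact (hd _).hasDerivAt.comp_hasFDerivAt a h2
    have h3 := (HasFDerivAt.fun_sum (fun i (_ : i ∈ Finset.univ) => h1 i)).const_mul (1 / (n:ℝ))
    refine h3.congr_fderiv ?_
    ext v
    simp [sum_inner, inner_smul_left, mul_assoc, ContinuousLinearMap.sum_apply]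
  have hgrad : ∀ a z, R a + ⟪gradient R a, z - a⟫ ≤ R z := by
    intro a z
    rw [(hgradR a).gradient, hR]
    simp only [inner_smul_left, sum_inner, conj_trivial]
    rw [← mul_add, ← Finset.sum_add_distrib]
    apply mul_le_mul_of_nonneg_left _ (by positivity)
    apply Finset.sum_le_sum
    intro i _
    have := aux_tangent ℓ hconv hd (y i * ⟪a, x i⟫) (y i * ⟪z, x i⟫)
    rw [real_inner_comm (z - a) (x i), inner_sub_left] 
    linarith
  obtain ⟨i0, hi0⟩ := hDc
  obtain ⟨e, he1, hei, hej⟩ := (hInC i0).1 hi0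
  have he : ∀ a, ∀ r : ℝ, 0 < r → R (a + r • e) < R a := by
    intro a r hr
    rw [hR]
    simp only
    apply mul_lt_mul_of_pos_left _ (by positivity)
    apply Finset.sum_lt_sum
    · intro i _
      apply hanti.antitone
      rw [inner_add_left, inner_smul_left]
      simp only [conj_trivial]
      nlinarith [hej i, mul_nonneg hr.le (hej i)]
    · refine ⟨i0, Finset.mem_univ _, ?_⟩
      apply hanti
      rw [inner_add_left, inner_smul_left]
      simp only [conj_trivial]
      nlinarith [mul_pos hr hei]
  have hinf := aux_inf R (gradient R) η w wbar e hη hgrad hgd hdesc he hwbar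
  have hwb := aux_wbar R wbar e he1 he hwbar
  have hunit1 : ∀ u, Tendsto (fun B : ℝ => B⁻¹ • wbar B) atTop (nhds u) → ‖u‖ = 1 := by
    intro u hu
    refine tendsto_nhds_unique hu.norm (tendsto_const_nhds.congr' ?_)
    filter_upwards [eventually_gt_atTop 0] with B hB
    rw [norm_smul, hwb B hB.le, norm_inv, Real.norm_of_nonneg hB.le, inv_mul_cancel₀ hB.ne']
  have hunit2 : ∀ u, Tendsto (fun t : ℕ => ‖w t‖⁻¹ • w t) atTop (nhds u) → ‖u‖ = 1 := by
    intro u hu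
    refine tendsto_nhds_unique hu.norm (tendsto_const_nhds.congr' ?_)
    filter_upwards [hinf.eventually_gt_atTop 0] with t ht
    rw [norm_smul, norm_inv, norm_norm, inv_mul_cancel₀ ht.ne']
  have fwd := fun u hu => aux_forward R (gradient R) η w wbar e hη hR0 hgrad hgd hdesc he1 he hwbar
    u hu (hunit1 u hu)
  have bwd := fun u hu => aux_backward R (gradient R) η w wbar e hη hR0 hgrad hgd hdesc he1 he hwbar
    u hu (hunit2 u hu)
  refine ⟨hinf, ?_, ⟨fun ⟨u, hu⟩ => ⟨u, bwd u hu⟩, fun ⟨u, hu⟩ => ⟨u, fwd u hu⟩⟩, ?_⟩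
  · refine tendsto_id.congr' ?_
    filter_upwards [eventually_ge_atTop 0] with B hB
    rw [hwb B hB]; rfl
  intro u u' hu hu'
  have huu : u = u' := tendsto_nhds_unique hu (fwd u' hu')
  refine ⟨huu, ?_⟩
  rw [← huu] at hu'
  have hu1 := hunit2 u hu
  -- margins of the limit are nonnegative
  have hmar : ∀ i, 0 ≤ y i * ⟪u, x i⟫ := by
    intro i
    -- lower bound on the margins of the regularized solutions
    have hder : deriv ℓ 0 < 0 := by
      have h1 := aux_tangent ℓ hconv hd 0 (-1)
      have h2 := aux_tangent ℓ hconv hd 0 1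
      have h3 : ℓ 1 < ℓ 0 := hanti (by norm_num)
      linarith
    have hlow : ∀ B : ℝ, 0 ≤ B → (n * R 0) / deriv ℓ 0 ≤ y i * ⟪wbar B, x i⟫ := by
      intro B hB
      have h1 := (hwbar B hB).2 0 (by simpa using hB)
      have h2 : ℓ (y i * ⟪wbar B, x i⟫) ≤ n * R (wbar B) := by
        rw [hR]
        simp only
        rw [← mul_assoc, mul_one_div_cancel hn'.ne', one_mul]
        exact Finset.single_le_sum (f := fun i => ℓ (y i * ⟪wbar B, x i⟫))
          (fun j _ => (hpos _).le) (Finset.mem_univ i)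
      have h3 := aux_tangent ℓ hconv hd 0 (y i * ⟪wbar B, x i⟫)
      have h4 : n * R (wbar B) ≤ n * R 0 := mul_le_mul_of_nonneg_left h1 hn'.le
      rw [div_le_iff_of_neg hder]
      linarith [hpos 0]
    have hl1 : Tendsto (fun B : ℝ => B⁻¹ * ((n * R 0) / deriv ℓ 0)) atTop (nhds 0) := by
      simpa using tendsto_inv_atTop_zero.mul_const ((n * R 0) / deriv ℓ 0)
    have hl2 : Tendsto (fun B : ℝ => y i * ⟪B⁻¹ • wbar B, x i⟫) atTop (nhds (y i * ⟪u, x i⟫)) :=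
      (hu'.inner tendsto_const_nhds).const_mul (y i)
    refine le_of_tendsto_of_tendsto hl1 hl2 ?_
    filter_upwards [eventually_gt_atTop 0] with B hB
    rw [inner_smul_left]
    simp only [conj_trivial]
    have := mul_le_mul_of_nonneg_left (hlow B hB.le) (inv_pos.2 hB).le
    linarith
  rw [Submodule.mem_orthogonal, hS]
  intro v hv
  induction hv using Submodule.span_induction with
  | mem v hv =>
    obtain ⟨i, hi, rfl⟩ := hv
    have h1 : ¬ 0 < y i * ⟪u, x i⟫ := fun h => hi ((hInC i).2 ⟨u, hu1, h, hmar⟩)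
    have h2 : y i * ⟪u, x i⟫ = 0 := le_antisymm (not_lt.1 h1) (hmar i)
    have h3 : y i ≠ 0 := by rcases hy i with h | h <;> rw [h] <;> norm_num
    rw [real_inner_comm]
    exact (mul_eq_zero.1 h2).resolve_left h3
  | zero => simp
  | add a b _ _ ha hb => rw [inner_add_left, ha, hb, add_zero]
  | smul c a _ ha => rw [inner_smul_left, ha, mul_zero]
end
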